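/- arXiv:2405.04021 — 5 statements merged into one kernel-verified Lean document; each statement's English description precedes it below -/
import Mathlib

section
/- Let h : 𝒳 × 𝒮 → {0,1}^ℓ be a universal hash family. Let (A,B) be jointly distributed random variables with A over 𝒳 and B over a finite set 𝒴, and let S be uniform over 𝒮 independent of (A,B). Then Δ((h(A,S), S, B); (U_ℓ, S, B)) ≤ (1/2)·√(2^{−H̃∞(A|B)} · 2^ℓ), where U_ℓ is uniform over {0,1}^ℓ independent of (A,B,S). In particular, if 𝒳 = {0,1}^n and ℓ ≤ α + 2 − 2·log₂(1/ε), then h is an average case (n,α,ℓ,ε)-extractor. -/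
noncomputable section

/-- Statistical distance between two PMFs on a finite type. -/
def statDist {T : Type*} [Fintype T] (p q : PMF T) : ℝ :=
  (1 / 2) * ∑ v : T, |(p v).toReal - (q v).toReal|

/-- Independent product of two PMFs. -/
def pmfProd {α β : Type*} (p : PMF α) (q : PMF β) : PMF (α × β) :=
  p.bind fun a => q.map fun b => (a, b)

/-- Average conditional min-entropy `H̃∞(X|Y)` of a joint distribution `μ` on `X × Y`:
`−log₂ ( E_{y←Y} [ max_x Pr[X=x | Y=y] ] ) = −log₂ ( Σ_y max_x Pr[X=x, Y=y] )`. -/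
def avgCondMinEntropy {X Y : Type*} [Fintype X] [Fintype Y] (μ : PMF (X × Y)) : ℝ :=
  - Real.logb 2 (∑ y : Y, ⨆ x : X, (μ (x, y)).toReal)

/-- Universal hash family: for all `x ≠ y`, `Pr_S[h(x,S) = h(y,S)] ≤ 1/|Y|`. -/
def UniversalHash {X S Y : Type*} [Fintype S] [Fintype Y] [DecidableEq Y]
    (h : X → S → Y) : Prop :=
  ∀ x y : X, x ≠ y →
    ((Finset.univ.filter fun s => h x s = h y s).card : ℝ) / (Fintype.card S) ≤
      1 / (Fintype.card Y)

/-- Average case `(n,α,λ,ε)`-extractor (with input set `𝒳`, seed set `𝒮`, output set `𝒴`):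
for every jointly distributed `(X, Aux)` with `H̃∞(X|Aux) ≥ α`,
`Δ((E(X,R), Aux, R); (U, Aux, R)) ≤ ε` where `R` and `U` are uniform and independent. -/
def IsAvgExtractor {𝒳 𝒮 𝒴 : Type*} [Fintype 𝒳] [Fintype 𝒮] [Nonempty 𝒮]
    [Fintype 𝒴] [Nonempty 𝒴] (E : 𝒳 → 𝒮 → 𝒴) (α ε : ℝ) : Prop :=
  ∀ (Aux : Type) [Fintype Aux], ∀ μ : PMF (𝒳 × Aux),
    α ≤ avgCondMinEntropy μ →
    statDist
      ((pmfProd μ (PMF.uniformOfFintype 𝒮)).map fun z => (E z.1.1 z.2, z.1.2, z.2))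
      ((pmfProd (pmfProd μ (PMF.uniformOfFintype 𝒮)) (PMF.uniformOfFintype 𝒴)).map
        fun z => (z.2, z.1.1.2, z.1.2))
      ≤ ε

/-- Applying a bijection to both distributions does not change their statistical distance. -/
lemma statDist_map_equiv {T T' : Type*} [Fintype T] [Fintype T'] (e : T ≃ T') (p q : PMF T) :
    statDist (p.map e) (q.map e) = statDist p q := by
  have key (r : PMF T) (v : T) : (r.map e) (e v) = r v := by
    classical
    simp [PMF.map_apply, tsum_fintype]
  unfold statDist
  rw [← Equiv.sum_comp e]
  simp only [key]

lemma pmfProd_apply {α β : Type*} [Fintype α] [Fintype β] (p : PMF α) (q : PMF β) (z : α × β) :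
    pmfProd p q z = p z.1 * q z.2 := by
  classical
  obtain ⟨a, b⟩ := z
  simp only [pmfProd, PMF.bind_apply, PMF.map_apply, tsum_fintype, Prod.mk.injEq]
  rw [Finset.sum_eq_single a, Finset.sum_eq_single b] <;> simp +contextual [eq_comm]

open Classical in
lemma toReal_map_apply {α β : Type*} [Fintype α] (p : PMF α) (f : α → β) (v : β) :
    ((p.map f) v).toReal = ∑ a, if v = f a then (p a).toReal else 0 := by
  rw [PMF.map_apply, tsum_fintype, ENNReal.toReal_sum]
  · exact Finset.sum_congr rfl fun a _ => by split_ifs <;> simp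
  · intro a _
    split_ifs <;> simp [PMF.apply_ne_top]

lemma sum_toReal_eq_one {α : Type*} [Fintype α] (p : PMF α) : ∑ a, (p a).toReal = 1 := by
  rw [← ENNReal.toReal_sum fun a _ => p.apply_ne_top a, ← tsum_fintype (L := .unconditional α),
    p.tsum_coe, ENNReal.toReal_one]

lemma toReal_uniform {α : Type*} [Fintype α] [Nonempty α] (a : α) :
    (PMF.uniformOfFintype α a).toReal = (Fintype.card α : ℝ)⁻¹ := by
  simp

lemma map_hash_apply {X S Y U : Type*} [Fintype X] [Fintype S] [Nonempty S] [Fintype Y]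
    [DecidableEq U] (h : X → S → U) (μ : PMF (X × Y)) (u : U) (s : S) (y : Y) :
    (((pmfProd μ (PMF.uniformOfFintype S)).map
        fun z => (h z.1.1 z.2, z.2, z.1.2)) (u, s, y)).toReal =
      (∑ x, if h x s = u then (μ (x, y)).toReal else 0) * (Fintype.card S : ℝ)⁻¹ := by
  classical
  simp only [toReal_map_apply, pmfProd_apply, ENNReal.toReal_mul, toReal_uniform,
    Fintype.sum_prod_type, Prod.mk.injEq, Finset.sum_mul]
  refine Finset.sum_congr rfl fun x _ => ?_
  rw [Finset.sum_eq_single y, Finset.sum_eq_single s] <;> simp +contextual [eq_comm]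

lemma map_uniform_apply {X S Y U : Type*} [Fintype X] [Fintype S] [Nonempty S] [Fintype Y]
    [Fintype U] [Nonempty U] (μ : PMF (X × Y)) (u : U) (s : S) (y : Y) :
    (((pmfProd (pmfProd μ (PMF.uniformOfFintype S)) (PMF.uniformOfFintype U)).map
        fun z => (z.2, z.1.2, z.1.1.2)) (u, s, y)).toReal =
      (∑ x, (μ (x, y)).toReal) * (Fintype.card S : ℝ)⁻¹ * (Fintype.card U : ℝ)⁻¹ := by
  classical
  simp only [toReal_map_apply, pmfProd_apply, ENNReal.toReal_mul, toReal_uniform,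
    Fintype.sum_prod_type, Prod.mk.injEq, Finset.sum_mul]
  refine Finset.sum_congr rfl fun x _ => ?_
  rw [Finset.sum_eq_single y, Finset.sum_eq_single s, Finset.sum_eq_single u] <;>
    simp +contextual [eq_comm]

/-- The second moment of the hashed weights is controlled by the collision probabilities. -/
lemma UniversalHash.sum_sq_le {X S U : Type*} [Fintype X] [Fintype S] [Nonempty S] [Fintype U]
    [DecidableEq U] {h : X → S → U} (hU : UniversalHash h) (w : X → ℝ) (hw : ∀ x, 0 ≤ w x) :
    ∑ s, ∑ u, (∑ x, if h x s = u then w x else 0) ^ 2 ≤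
      Fintype.card S * (∑ x, w x ^ 2 + (∑ x, w x) ^ 2 / Fintype.card U) := by
  classical
  have hS : (0 : ℝ) < Fintype.card S := by exact_mod_cast Fintype.card_pos
  have expand : ∑ s, ∑ u, (∑ x, if h x s = u then w x else 0) ^ 2 =
      ∑ x, ∑ x', w x * w x' * (Finset.univ.filter fun s => h x s = h x' s).card := by
    have inner (s : S) : ∑ u, (∑ x, if h x s = u then w x else 0) ^ 2 =
        ∑ x, ∑ x', if h x s = h x' s then w x * w x' else 0 := by
      simp only [sq, Finset.sum_mul_sum]
      rw [Finset.sum_comm]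
      refine Finset.sum_congr rfl fun x _ => ?_
      rw [Finset.sum_comm]
      refine Finset.sum_congr rfl fun x' _ => ?_
      rw [Finset.sum_eq_single (h x s)] <;> simp +contextual [eq_comm]
    simp only [inner]
    rw [Finset.sum_comm]
    refine Finset.sum_congr rfl fun x _ => ?_
    rw [Finset.sum_comm]
    refine Finset.sum_congr rfl fun x' _ => ?_
    rw [← Finset.sum_filter, Finset.sum_const, nsmul_eq_mul, mul_comm]
  have bound (x x' : X) : w x * w x' * (Finset.univ.filter fun s => h x s = h x' s).card ≤
      Fintype.card S * ((if x = x' then w x ^ 2 else 0) + w x * w x' / Fintype.card U) := by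
    have hww := mul_nonneg (hw x) (hw x')
    by_cases hx : x = x'
    · subst hx
      have : 0 ≤ w x * w x / Fintype.card U := by positivity
      simp only [Finset.filter_true, Finset.card_univ, if_true]
      nlinarith
    · have := hU x x' hx
      rw [div_le_iff₀ hS] at this
      rw [if_neg hx, zero_add]
      calc _ ≤ w x * w x' * (1 / Fintype.card U * Fintype.card S) := by gcongr
        _ = _ := by ring
  rw [expand]
  refine (Finset.sum_le_sum fun x _ => Finset.sum_le_sum fun x' _ => bound x x').trans_eq ?_
  simp only [← Finset.mul_sum, Finset.sum_add_distrib, Finset.sum_ite_eq, Finset.mem_univ,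
    if_true, ← Finset.sum_div, sq (∑ x, w x), Finset.sum_mul_sum]

/-- The unnormalised `ℓ¹` deviation from uniform, for a fixed weight on the inputs. -/
lemma UniversalHash.sum_abs_le {X S U : Type*} [Fintype X] [Fintype S] [Nonempty S] [Fintype U]
    [Nonempty U] [DecidableEq U] {h : X → S → U} (hU : UniversalHash h) (w : X → ℝ)
    (hw : ∀ x, 0 ≤ w x) :
    ∑ u, ∑ s, |(∑ x, if h x s = u then w x else 0) * (Fintype.card S : ℝ)⁻¹ -
        (∑ x, w x) * (Fintype.card S : ℝ)⁻¹ * (Fintype.card U : ℝ)⁻¹| ≤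
      √(Fintype.card U * ∑ x, w x ^ 2) := by
  have hS : (0 : ℝ) < Fintype.card S := by exact_mod_cast Fintype.card_pos
  have hM : (0 : ℝ) < Fintype.card U := by exact_mod_cast Fintype.card_pos
  have second := hU.sum_sq_le w hw
  have first : ∑ s, ∑ u, (∑ x, if h x s = u then w x else 0) = Fintype.card S * ∑ x, w x := by
    have (s : S) : ∑ u, (∑ x, if h x s = u then w x else 0) = ∑ x, w x := by
      rw [Finset.sum_comm]
      simp
    simp [this]
  set g : S → U → ℝ := fun s u => ∑ x, if h x s = u then w x else 0
  set W := ∑ x, w x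
  set N : ℝ := (Fintype.card S : ℝ) with hN
  set M : ℝ := (Fintype.card U : ℝ) with hM'
  have sq_sum : ∑ s, ∑ u, (g s u * N⁻¹ - W * N⁻¹ * M⁻¹) ^ 2 =
      (∑ s, ∑ u, g s u ^ 2) * N⁻¹ ^ 2 - W ^ 2 * N⁻¹ * M⁻¹ := by
    have (s : S) (u : U) : (g s u * N⁻¹ - W * N⁻¹ * M⁻¹) ^ 2 =
        g s u ^ 2 * N⁻¹ ^ 2 - g s u * (2 * W * N⁻¹ ^ 2 * M⁻¹) + (W * N⁻¹ * M⁻¹) ^ 2 := by ring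
    simp only [this, Finset.sum_add_distrib, Finset.sum_sub_distrib, ← Finset.sum_mul]
    change _ - (∑ s, ∑ u, g s u) * _ + _ = _
    rw [show (∑ s, ∑ u, g s u) = N * W from first]
    simp only [Finset.sum_const, Finset.card_univ, nsmul_eq_mul, ← hN, ← hM']
    field_simp
    ring
  apply Real.le_sqrt_of_sq_le
  rw [Finset.sum_comm, ← Fintype.sum_prod_type' fun s u => |g s u * N⁻¹ - W * N⁻¹ * M⁻¹|]
  refine (sq_sum_le_card_mul_sum_sq (s := Finset.univ)).trans ?_
  simp only [sq_abs, Finset.card_univ, Fintype.card_prod, Nat.cast_mul]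
  rw [Fintype.sum_prod_type, ← hN, ← hM']
  change N * M * (∑ s, ∑ u, (g s u * N⁻¹ - W * N⁻¹ * M⁻¹) ^ 2) ≤ _
  rw [sq_sum]
  calc _ ≤ N * M * (N * (∑ x, w x ^ 2 + W ^ 2 / M) * N⁻¹ ^ 2 - W ^ 2 * N⁻¹ * M⁻¹) := by gcongr
    _ = _ := by field_simp; ring

/-- The guessing probability of the first component given the second is `2 ^ (-H̃∞)`. -/
lemma two_rpow_neg_avgCondMinEntropy {X Y : Type*} [Fintype X] [Fintype Y] (μ : PMF (X × Y)) :
    (2 : ℝ) ^ (-avgCondMinEntropy μ) = ∑ y, ⨆ x, (μ (x, y)).toReal := by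
  obtain ⟨⟨x, y⟩, hxy⟩ := μ.support_nonempty
  rw [avgCondMinEntropy, neg_neg, Real.rpow_logb (by norm_num) (by norm_num)]
  refine Finset.sum_pos' (fun y _ => Real.iSup_nonneg fun x => ENNReal.toReal_nonneg)
    ⟨y, Finset.mem_univ y, ?_⟩
  exact (ENNReal.toReal_pos ((μ.mem_support_iff _).1 hxy) (μ.apply_ne_top _)).trans_le
    (le_ciSup (f := fun x => (μ (x, y)).toReal) (Set.finite_range _).bddAbove x)

lemma UniversalHash.statDist_le {X S Y U : Type*} [Fintype X] [Fintype S] [Nonempty S]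
    [Fintype Y] [Fintype U] [Nonempty U] [DecidableEq U] {h : X → S → U} (hU : UniversalHash h)
    (μ : PMF (X × Y)) :
    statDist
      ((pmfProd μ (PMF.uniformOfFintype S)).map fun z => (h z.1.1 z.2, z.2, z.1.2))
      ((pmfProd (pmfProd μ (PMF.uniformOfFintype S)) (PMF.uniformOfFintype U)).map
        fun z => (z.2, z.1.2, z.1.1.2)) ≤
      (1 / 2) * √((2 : ℝ) ^ (-avgCondMinEntropy μ) * Fintype.card U) := by
  rw [two_rpow_neg_avgCondMinEntropy]
  unfold statDist
  refine mul_le_mul_of_nonneg_left ?_ (by norm_num)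
  simp only [Fintype.sum_prod_type, map_hash_apply, map_uniform_apply]
  have hcomm (F : U → S → Y → ℝ) : ∑ u, ∑ s, ∑ y, F u s y = ∑ y, ∑ u, ∑ s, F u s y := by
    rw [Finset.sum_comm (s := (Finset.univ : Finset Y))]
    exact Finset.sum_congr rfl fun u _ => Finset.sum_comm
  rw [hcomm]
  set m : Y → ℝ := fun y => ⨆ x, (μ (x, y)).toReal
  have hm (y : Y) : 0 ≤ m y := Real.iSup_nonneg fun x => ENNReal.toReal_nonneg
  have hle (x : X) (y : Y) : (μ (x, y)).toReal ≤ m y :=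
    le_ciSup (f := fun x => (μ (x, y)).toReal) (Set.finite_range _).bddAbove x
  have htotal : ∑ y, ∑ x, (μ (x, y)).toReal = 1 := by
    rw [← Fintype.sum_prod_type_right', sum_toReal_eq_one]
  calc _ ≤ ∑ y, √(Fintype.card U * ∑ x, (μ (x, y)).toReal ^ 2) :=
        Finset.sum_le_sum fun y _ =>
          hU.sum_abs_le (fun x => (μ (x, y)).toReal) fun x => ENNReal.toReal_nonneg
    _ ≤ ∑ y, √(m y * Fintype.card U) * √(∑ x, (μ (x, y)).toReal) := by
        refine Finset.sum_le_sum fun y _ => ?_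
        rw [← Real.sqrt_mul (mul_nonneg (hm y) (Nat.cast_nonneg _)), mul_comm (m y), mul_assoc,
          Finset.mul_sum _ _ (m y)]
        gcongr Real.sqrt (_ * ?_)
        refine Finset.sum_le_sum fun x _ => ?_
        rw [sq]
        exact mul_le_mul_of_nonneg_right (hle x y) ENNReal.toReal_nonneg
    _ ≤ √(∑ y, m y * Fintype.card U) * √(∑ y, ∑ x, (μ (x, y)).toReal) :=
        Real.sum_sqrt_mul_sqrt_le _ (fun y => mul_nonneg (hm y) (Nat.cast_nonneg _))
          fun y => Finset.sum_nonneg fun x _ => ENNReal.toReal_nonneg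
    _ = _ := by rw [htotal, Real.sqrt_one, mul_one, Finset.sum_mul]

/-- **generalized leftover hash lemma.** Let `h : 𝒳 × 𝒮 → {0,1}^ℓ` be a
universal hash family.  For jointly distributed `(A,B)` and `S` uniform over `𝒮`
independent of `(A,B)`, `Δ((h(A,S), S, B); (U_ℓ, S, B)) ≤ (1/2)·√(2^{−H̃∞(A|B)}·2^ℓ)`.
In particular, if `ℓ ≤ α + 2 − 2·log₂(1/ε)` then `h` is an average case
`(n,α,ℓ,ε)`-extractor. -/
theorem leftover_hash_lemma {𝒳 𝒮 : Type} [Fintype 𝒳] [Fintype 𝒮] [Nonempty 𝒮] (ℓ : ℕ)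
    (h : 𝒳 → 𝒮 → (Fin ℓ → Bool)) (hUniv : UniversalHash h) :
    (∀ (𝒴 : Type) [Fintype 𝒴], ∀ μ : PMF (𝒳 × 𝒴),
      statDist
        ((pmfProd μ (PMF.uniformOfFintype 𝒮)).map fun z => (h z.1.1 z.2, z.2, z.1.2))
        ((pmfProd (pmfProd μ (PMF.uniformOfFintype 𝒮))
            (PMF.uniformOfFintype (Fin ℓ → Bool))).map fun z => (z.2, z.1.2, z.1.1.2))
        ≤ (1 / 2) * Real.sqrt ((2 : ℝ) ^ (-(avgCondMinEntropy μ)) * 2 ^ ℓ)) ∧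
    (∀ α ε : ℝ, 0 < ε → (ℓ : ℝ) ≤ α + 2 - 2 * Real.logb 2 (1 / ε) →
      IsAvgExtractor h α ε) := by
  have bound {𝒴 : Type} [Fintype 𝒴] (μ : PMF (𝒳 × 𝒴)) := hUniv.statDist_le μ
  simp only [Fintype.card_pi, Fintype.card_bool, Finset.prod_const, Finset.card_univ,
    Fintype.card_fin, Nat.cast_pow, Nat.cast_ofNat] at bound
  refine ⟨fun 𝒴 _ μ => bound μ, fun α ε hε hℓ Aux _ μ hμ => ?_⟩
  let e : (Fin ℓ → Bool) × 𝒮 × Aux ≃ (Fin ℓ → Bool) × Aux × 𝒮 :=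
    (Equiv.refl _).prodCongr (Equiv.prodComm 𝒮 Aux)
  have hb := bound μ
  rw [← statDist_map_equiv e, PMF.map_comp, PMF.map_comp] at hb
  refine hb.trans ?_
  have hpow : (2 : ℝ) ^ (-avgCondMinEntropy μ) * 2 ^ ℓ ≤ (2 * ε) ^ 2 := by
    have hlog : Real.logb 2 (1 / ε) = -Real.logb 2 ε := by rw [one_div, Real.logb_inv]
    calc (2 : ℝ) ^ (-avgCondMinEntropy μ) * 2 ^ ℓ
        = (2 : ℝ) ^ (-avgCondMinEntropy μ + ℓ) := by
          rw [Real.rpow_add two_pos, Real.rpow_natCast]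
      _ ≤ (2 : ℝ) ^ ((1 + Real.logb 2 ε) * (2 : ℕ)) := by
          apply Real.rpow_le_rpow_of_exponent_le one_le_two
          push_cast
          linarith
      _ = (2 * ε) ^ 2 := by
          rw [Real.rpow_mul_natCast two_pos.le, Real.rpow_add two_pos, Real.rpow_one,
            Real.rpow_logb two_pos (by norm_num) hε]
  have := Real.sqrt_le_sqrt hpow
  rw [Real.sqrt_sq (by positivity)] at this
  linarith

end
end

section
/- Let W be an (α,m,N)-source over {0,1}^n and let E : {0,1}^m × {0,1}^r → {0,1}^ν be an average case (m,α,ν,ε)-extractor with the additional property that E(Ũ, Z) is uniform over {0,1}^ν whenever Ũ is uniform over {0,1}^m and Z is an independent uniform seed. Let Z be uniform over {0,1}^r and let A_1,…,A_μ be independent uniformly random subsets of {1,…,n} of cardinality m, all independent of W, and set d_i = E(W[A_i], Z) for i = 1,…,μ. If μ·m < N, then Δ((d_1,…,d_μ, Z, A_1,…,A_μ); (U_1,…,U_μ, Z, A_1,…,A_μ)) ≤ μ·ε, where U_1,…,U_μ are independent uniform random variables over {0,1}^ν, independent of (Z, A_1,…,A_μ). -/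
noncomputable section

lemma mSub_nonempty {α : Type*} [Fintype α] [DecidableEq α] {m : ℕ}
    (h : m ≤ Fintype.card α) : Nonempty {A : Finset α // A.card = m} := by
  obtain ⟨t, -, ht⟩ := Finset.exists_subset_card_eq
    (show m ≤ (Finset.univ : Finset α).card by simpa using h)
  exact ⟨⟨t, ht⟩⟩

/-- `k` independent uniformly random `m`-subsets. -/
def uniformSubsets (α : Type*) [Fintype α] [DecidableEq α] (m k : ℕ)
    (h : m ≤ Fintype.card α) : PMF (Fin k → {A : Finset α // A.card = m}) :=
  haveI : Nonempty {A : Finset α // A.card = m} := mSub_nonempty h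
  PMF.uniformOfFintype _

/-- A uniformly random `m`-subset. -/
def uniformSubset (α : Type*) [Fintype α] [DecidableEq α] (m : ℕ)
    (h : m ≤ Fintype.card α) : PMF {A : Finset α // A.card = m} :=
  haveI : Nonempty {A : Finset α // A.card = m} := mSub_nonempty h
  PMF.uniformOfFintype _

/-- The masked substring `w[A]`. -/
def subsample {α : Type*} [DecidableEq α] (w : α → Bool) (A : Finset α) :
    α → Option Bool :=
  fun i => if i ∈ A then some (w i) else none

/-- The substring of `w` indexed by the `m`-subset `A` (in increasing order of positions). -/
def sampleBits {n m : ℕ} (w : Fin n → Bool) (A : {s : Finset (Fin n) // s.card = m}) :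
    Fin m → Bool :=
  fun i => w (A.1.orderIsoOfFin A.2 i).1

/-- `(α,m,N)`-source over `{0,1}^n`: for independent uniformly random subsets `A`, `B` of
cardinalities `m`, `N`, chosen independently of `W`, `H̃∞(W[A] | (W[B],A,B)) ≥ α`. -/
def IsAlphaSource (n : ℕ) (Wd : PMF (Fin n → Bool)) (α : ℝ) (m N : ℕ)
    (hm : m ≤ n) (hN : N ≤ n) : Prop :=
  α ≤ avgCondMinEntropy (do
    let w ← Wd
    let A ← uniformSubset (Fin n) m (by simpa using hm)
    let B ← uniformSubset (Fin n) N (by simpa using hN)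
    return (subsample w A.1, (subsample w B.1, A, B)))

lemma statDist_triangle {T : Type*} [Fintype T] (p q s : PMF T) :
    statDist p s ≤ statDist p q + statDist q s := by
  unfold statDist
  rw [← mul_add, ← Finset.sum_add_distrib]
  gcongr
  exact abs_sub_le _ _ _

lemma PMF.sum_toReal {T : Type*} [Fintype T] (p : PMF T) : ∑ v, (p v).toReal = 1 := by
  rw [← ENNReal.toReal_sum fun v _ => p.apply_ne_top v, ← tsum_fintype (L := .unconditional T),
    p.tsum_coe, ENNReal.toReal_one]

lemma PMF.bind_apply_toReal {S T : Type*} [Fintype S] (p : PMF S) (κ : S → PMF T) (v : T) :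
    (p.bind κ v).toReal = ∑ a, (p a).toReal * (κ a v).toReal := by
  rw [PMF.bind_apply, tsum_fintype, ENNReal.toReal_sum]
  · simp only [ENNReal.toReal_mul]
  · exact fun a _ => ENNReal.mul_ne_top (p.apply_ne_top a) ((κ a).apply_ne_top v)

/-- Data processing inequality for the statistical distance. -/
lemma statDist_bind_le {S T : Type*} [Fintype S] [Fintype T] (p q : PMF S) (κ : S → PMF T) :
    statDist (p.bind κ) (q.bind κ) ≤ statDist p q := by
  unfold statDist
  gcongr 1 / 2 * ?_
  calc ∑ v, |(p.bind κ v).toReal - (q.bind κ v).toReal|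
      ≤ ∑ v, ∑ a, |(p a).toReal - (q a).toReal| * (κ a v).toReal := by
        gcongr with v
        rw [PMF.bind_apply_toReal, PMF.bind_apply_toReal, ← Finset.sum_sub_distrib]
        refine (Finset.abs_sum_le_sum_abs _ _).trans_eq (Finset.sum_congr rfl fun a _ => ?_)
        rw [← sub_mul, abs_mul, abs_of_nonneg (ENNReal.toReal_nonneg (a := κ a v))]
    _ = ∑ a, |(p a).toReal - (q a).toReal| := by
        rw [Finset.sum_comm]
        simp only [← Finset.mul_sum, PMF.sum_toReal, mul_one]

lemma statDist_self {T : Type*} [Fintype T] (p : PMF T) : statDist p p = 0 := by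
  simp [statDist]

/-- If `g` is determined by `f` and `h`, then `f` is at least as hard to guess from `h` as `g`. -/
lemma avgCondMinEntropy_map_le {Ω X X' Y : Type*} [Fintype X] [Fintype X'] [Fintype Y]
    (q : PMF Ω) (f : Ω → X') (g : Ω → X) (h : Ω → Y)
    (hfg : ∀ ω ω', f ω = f ω' → h ω = h ω' → g ω = g ω') :
    avgCondMinEntropy (q.map fun ω => (g ω, h ω)) ≤
      avgCondMinEntropy (q.map fun ω => (f ω, h ω)) := by
  classical
  obtain ⟨ω₀, -⟩ := q.support_nonempty
  have : Nonempty X := ⟨g ω₀⟩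
  have : Nonempty X' := ⟨f ω₀⟩
  have hle : ∀ y x', ∃ x, q.map (fun ω => (f ω, h ω)) (x', y) ≤
      q.map (fun ω => (g ω, h ω)) (x, y) := by
    intro y x'
    by_cases hex : ∃ ω, f ω = x' ∧ h ω = y
    · obtain ⟨ω, rfl, rfl⟩ := hex
      refine ⟨g ω, ?_⟩
      rw [PMF.map_apply, PMF.map_apply]
      refine ENNReal.tsum_le_tsum fun ω' => ?_
      split_ifs with h₁ h₂
      · exact le_rfl
      · rw [Prod.mk.injEq] at h₁
        exact absurd (Prod.ext (hfg _ _ h₁.1 h₁.2) h₁.2) h₂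
      · exact zero_le
      · exact le_rfl
    · refine ⟨g ω₀, le_of_eq_of_le ?_ zero_le⟩
      rw [PMF.map_apply, ENNReal.tsum_eq_zero]
      intro ω
      rw [if_neg]
      rintro h₁
      rw [Prod.mk.injEq] at h₁
      exact hex ⟨ω, h₁.1.symm, h₁.2.symm⟩
  unfold avgCondMinEntropy
  rw [neg_le_neg_iff]
  refine Real.logb_le_logb_of_le one_lt_two ?_ (Finset.sum_le_sum fun y _ => ciSup_le fun x' => ?_)
  · obtain ⟨⟨x, y⟩, hxy⟩ := (q.map fun ω => (f ω, h ω)).support_nonempty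
    refine Finset.sum_pos' (fun y _ => Real.iSup_nonneg fun x => ENNReal.toReal_nonneg)
      ⟨y, Finset.mem_univ _, ?_⟩
    refine lt_of_lt_of_le ?_ (le_ciSup (Set.finite_range _).bddAbove x)
    exact ENNReal.toReal_pos ((PMF.mem_support_iff _ _).1 hxy) (PMF.apply_ne_top _ _)
  · obtain ⟨x, hx⟩ := hle y x'
    exact (ENNReal.toReal_mono (PMF.apply_ne_top _ _) hx).trans
      (le_ciSup (f := fun x => (PMF.map _ q (x, y)).toReal) (Set.finite_range _).bddAbove x)

lemma PMF.uniformOfFintype_eq_bind {α β γ : Type*} [Fintype α] [Nonempty α] [Fintype β]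
    [Nonempty β] [Fintype γ] [Nonempty γ] (e : α × β ≃ γ) :
    PMF.uniformOfFintype γ = (PMF.uniformOfFintype α).bind fun a =>
      (PMF.uniformOfFintype β).bind fun b => PMF.pure (e (a, b)) := by
  classical
  ext c
  obtain ⟨⟨a, b⟩, rfl⟩ := e.surjective c
  have hc : Fintype.card γ = Fintype.card α * Fintype.card β := by
    rw [← Fintype.card_congr e, Fintype.card_prod]
  simp only [PMF.bind_apply, tsum_fintype, PMF.uniformOfFintype_apply, PMF.pure_apply,
    e.injective.eq_iff, Prod.mk.injEq, ite_and, hc, Nat.cast_mul]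
  simp [ENNReal.mul_inv]

lemma PMF.uniformOfFintype_fin_succ {S : Type*} [Fintype S] [Nonempty S] (k : ℕ) :
    PMF.uniformOfFintype (Fin (k + 1) → S) = (PMF.uniformOfFintype S).bind fun a =>
      (PMF.uniformOfFintype (Fin k → S)).bind fun A => PMF.pure (Fin.cons a A) :=
  PMF.uniformOfFintype_eq_bind (Fin.consEquiv fun _ => S)

/-- Subsets of equal cardinality are conjugate under a permutation. -/
lemma Finset.exists_perm_mem_iff {α : Type*} [Fintype α] [DecidableEq α] {s t : Finset α}
    (h : s.card = t.card) : ∃ σ : Equiv.Perm α, ∀ x, σ x ∈ t ↔ x ∈ s := by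
  let e : {x // x ∈ s} ≃ {x // x ∈ t} := Fintype.equivOfCardEq (by simpa using h)
  refine ⟨e.extendSubtype, fun x => ⟨fun hx => ?_, fun hx => e.extendSubtype_mem x hx⟩⟩
  by_contra hxs
  exact e.extendSubtype_not_mem x hxs hx

/-- The action of a permutation on the subsets of a given cardinality. -/
def permSubsets {α : Type*} (σ : Equiv.Perm α) (m : ℕ) :
    Equiv.Perm {A : Finset α // A.card = m} :=
  σ.finsetCongr.subtypeEquiv fun A => by simp

lemma mem_permSubsets {α : Type*} (σ : Equiv.Perm α) {m : ℕ} (A : {A : Finset α // A.card = m})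
    (x : α) : σ x ∈ (permSubsets σ m A).1 ↔ x ∈ A.1 := by
  simp [permSubsets]

lemma permSubsets_subset_iff {α : Type*} (σ : Equiv.Perm α) {m N : ℕ}
    (A : {A : Finset α // A.card = m}) (B : {B : Finset α // B.card = N}) :
    (permSubsets σ m A).1 ⊆ (permSubsets σ N B).1 ↔ A.1 ⊆ B.1 := by
  simp [permSubsets]

/-- Independent uniformly random `m`-subsets can be sampled inside a uniformly random `N`-subset,
provided that they fit. -/
lemma exists_kernel_uniformSubsets {α : Type*} [Fintype α] [DecidableEq α] {m N k : ℕ}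
    (hm : m ≤ Fintype.card α) (hN : N ≤ Fintype.card α) (hk : k * m ≤ N) :
    ∃ K : {B : Finset α // B.card = N} → PMF (Fin k → {A : Finset α // A.card = m}),
      (uniformSubset α N hN).bind K = uniformSubsets α m k hm ∧
      ∀ B, ∀ A ∈ (K B).support, ∀ i, (A i).1 ⊆ B.1 := by
  classical
  have : Nonempty {A : Finset α // A.card = m} := mSub_nonempty hm
  have : Nonempty {B : Finset α // B.card = N} := mSub_nonempty hN
  let 𝒜 := Fin k → {A : Finset α // A.card = m}
  let 𝓑 := {B : Finset α // B.card = N}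
  let R : 𝒜 → 𝓑 → Prop := fun A B => ∀ i, (A i).1 ⊆ B.1
  let c : 𝒜 → ℕ := fun A => (Finset.univ.filter fun B => R A B).card
  let b : ENNReal := Fintype.card 𝓑
  let a : ENNReal := Fintype.card 𝒜
  have hb : b ≠ 0 := by simp only [b, ne_eq, Nat.cast_eq_zero]; exact Fintype.card_ne_zero
  have hb' : b ≠ ⊤ := ENNReal.natCast_ne_top _
  have ha : a ≠ 0 := by simp only [a, ne_eq, Nat.cast_eq_zero]; exact Fintype.card_ne_zero
  have ha' : a ≠ ⊤ := ENNReal.natCast_ne_top _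
  have hc : ∀ A, (c A : ENNReal) ≠ 0 := by
    intro A
    have hcard : (Finset.univ.biUnion fun i => (A i).1).card ≤ N := by
      refine Finset.card_biUnion_le.trans ?_
      simpa [(A _).2] using hk
    obtain ⟨B, hAB, -, hB⟩ := Finset.exists_subsuperset_card_eq
      (Finset.subset_univ (Finset.univ.biUnion fun i => (A i).1)) hcard (by simpa using hN)
    have : (⟨B, hB⟩ : 𝓑) ∈ Finset.univ.filter fun B => R A B := by
      simp only [Finset.mem_filter, Finset.mem_univ, true_and]
      exact fun i => (Finset.subset_biUnion_of_mem (fun i => (A i).1) (Finset.mem_univ i)).trans hAB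
    exact_mod_cast (Finset.card_pos.2 ⟨_, this⟩).ne'
  let wt : 𝓑 → 𝒜 → ENNReal := fun B A => if R A B then a⁻¹ * (b * (c A : ENNReal)⁻¹) else 0
  have hmarg : ∀ A, ∑ B, wt B A = b * a⁻¹ := by
    intro A
    have : ∑ B, wt B A = c A * (a⁻¹ * (b * (c A : ENNReal)⁻¹)) := by
      refine (Finset.sum_filter _ _).symm.trans ?_
      rw [Finset.sum_const, nsmul_eq_mul]
    rw [this, show (c A : ENNReal) * (a⁻¹ * (b * (c A : ENNReal)⁻¹)) =
      b * a⁻¹ * (c A * (c A : ENNReal)⁻¹) by ring,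
      ENNReal.mul_inv_cancel (hc A) (ENNReal.natCast_ne_top _), mul_one]
  have hconst : ∀ B B', ∑ A, wt B A = ∑ A, wt B' A := by
    intro B B'
    obtain ⟨σ, hσ⟩ := Finset.exists_perm_mem_iff (B.2.trans B'.2.symm)
    have hB' : B' = permSubsets σ N B := by
      ext x
      obtain ⟨x, rfl⟩ := σ.surjective x
      rw [mem_permSubsets, hσ]
    let τ : 𝒜 ≃ 𝒜 := Equiv.piCongrRight fun _ => permSubsets σ m
    have hR : ∀ A B, R (τ A) (permSubsets σ N B) ↔ R A B := fun A B =>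
      forall_congr' fun i => permSubsets_subset_iff σ (A i) B
    have hcτ : ∀ A, c (τ A) = c A := fun A => by
      refine (Finset.card_equiv (permSubsets σ N) fun B => ?_).symm
      simp [hR]
    rw [hB']
    refine (Finset.sum_congr rfl fun A _ => ?_).trans (Equiv.sum_comp τ _)
    simp only [wt, hcτ]
    exact if_congr (hR A B).symm rfl rfl
  have hsum : ∀ B, ∑ A, wt B A = 1 := by
    intro B
    have h₁ : ∑ B', ∑ A, wt B' A = b * ∑ A, wt B A := by
      rw [Finset.sum_congr rfl fun B' _ => hconst B' B, Finset.sum_const, nsmul_eq_mul,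
        Finset.card_univ]
    have h₂ : ∑ B', ∑ A, wt B' A = b * 1 := by
      rw [Finset.sum_comm, Finset.sum_congr rfl fun A _ => hmarg A, Finset.sum_const,
        nsmul_eq_mul, Finset.card_univ]
      change a * (b * a⁻¹) = b * 1
      rw [mul_left_comm, ENNReal.mul_inv_cancel ha ha']
    exact (ENNReal.mul_right_inj hb hb').1 (h₁.symm.trans h₂)
  refine ⟨fun B => PMF.ofFintype (wt B) (hsum B), ?_, fun B A hA => ?_⟩
  · ext A
    simp only [uniformSubset, uniformSubsets, PMF.bind_apply, tsum_fintype,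
      PMF.uniformOfFintype_apply, PMF.ofFintype_apply, ← Finset.mul_sum]
    change b⁻¹ * ∑ B, wt B A = a⁻¹
    rw [hmarg, ← mul_assoc, ENNReal.inv_mul_cancel hb hb', one_mul]
  · by_contra hR
    exact hA (by simp only [PMF.ofFintype_apply, wt]; exact if_neg hR)

lemma uniformSubsets_succ (α : Type*) [Fintype α] [DecidableEq α] (m k : ℕ)
    (h : m ≤ Fintype.card α) :
    uniformSubsets α m (k + 1) h = (uniformSubset α m h).bind fun a =>
      (uniformSubsets α m k h).bind fun A => PMF.pure (Fin.cons a A) :=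
  haveI : Nonempty {A : Finset α // A.card = m} := mSub_nonempty h
  PMF.uniformOfFintype_fin_succ k

lemma sampleBits_congr {n m : ℕ} {w w' : Fin n → Bool} (A : {s : Finset (Fin n) // s.card = m})
    (h : ∀ i ∈ A.1, w i = w' i) : sampleBits w A = sampleBits w' A :=
  funext fun i => h _ (A.1.orderIsoOfFin A.2 i).2

lemma subsample_eq_of_sampleBits_eq {n m : ℕ} {w w' : Fin n → Bool}
    {A : {s : Finset (Fin n) // s.card = m}} (h : sampleBits w A = sampleBits w' A) :
    subsample w A.1 = subsample w' A.1 := by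
  funext j
  unfold subsample
  split_ifs with hj
  · have := congrFun h ((A.1.orderIsoOfFin A.2).symm ⟨j, hj⟩)
    simp only [sampleBits, OrderIso.apply_symm_apply] at this
    rw [this]
  · rfl

lemma PMF.bind_congr {S T : Type*} (p : PMF S) {f g : S → PMF T}
    (h : ∀ a ∈ p.support, f a = g a) : p.bind f = p.bind g := by
  ext v
  rw [PMF.bind_apply, PMF.bind_apply]
  refine tsum_congr fun a => ?_
  by_cases ha : p a = 0
  · simp [ha]
  · rw [h a ((PMF.mem_support_iff _ _).2 ha)]

lemma statDist_extract_succ_le {n m N ν r k : ℕ} {α ε : ℝ} (hm : m ≤ n) (hN : N ≤ n)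
    {Wd : PMF (Fin n → Bool)} (hW : IsAlphaSource n Wd α m N hm hN)
    {E : (Fin m → Bool) → (Fin r → Bool) → (Fin ν → Bool)}
    (hE : IsAvgExtractor E α ε) (hk : k * m ≤ N) (h : m ≤ Fintype.card (Fin n)) :
    statDist
      (Wd.bind fun w => (PMF.uniformOfFintype (Fin r → Bool)).bind fun Z =>
        (uniformSubsets (Fin n) m (k + 1) h).bind fun A =>
          PMF.pure ((fun i => E (sampleBits w (A i)) Z), Z, A))
      (Wd.bind fun w => (PMF.uniformOfFintype (Fin r → Bool)).bind fun Z =>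
        (uniformSubsets (Fin n) m k h).bind fun A => (uniformSubset (Fin n) m h).bind fun a =>
          (PMF.uniformOfFintype (Fin ν → Bool)).bind fun u =>
            PMF.pure ((Fin.cons u fun i => E (sampleBits w (A i)) Z : Fin (k + 1) → _), Z,
              (Fin.cons a A : Fin (k + 1) → _))) ≤ ε := by
  have hN' : N ≤ Fintype.card (Fin n) := by simpa using hN
  obtain ⟨K, hK, hKsub⟩ := exists_kernel_uniformSubsets h hN' hk
  let q := Wd.bind fun w => (uniformSubset (Fin n) m h).bind fun a =>
    (uniformSubset (Fin n) N hN').bind fun B => PMF.pure (w, a, B)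
  let μ := q.map fun ω => (sampleBits ω.1 ω.2.1, (subsample ω.1 ω.2.2.1, ω.2.1, ω.2.2))
  have hμ : α ≤ avgCondMinEntropy μ := by
    refine le_trans ?_ (avgCondMinEntropy_map_le q _ (fun ω => subsample ω.1 ω.2.1.1) _ ?_)
    · have hW' : α ≤ avgCondMinEntropy (Wd.bind fun w => (uniformSubset (Fin n) m h).bind fun a =>
          (uniformSubset (Fin n) N hN').bind fun B =>
            PMF.pure (subsample w a.1, (subsample w B.1, a, B))) := hW
      simpa only [q, PMF.map_bind, PMF.pure_map] using hW'
    · rintro ⟨w, a, B⟩ ⟨w', a', B'⟩ hf hh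
      simp only [Prod.mk.injEq] at hf hh
      obtain ⟨-, rfl, rfl⟩ := hh
      exact subsample_eq_of_sampleBits_eq hf
  let κ : (Fin ν → Bool) × ((Fin n → Option Bool) × {A : Finset (Fin n) // A.card = m} ×
      {B : Finset (Fin n) // B.card = N}) × (Fin r → Bool) →
      PMF ((Fin (k + 1) → Fin ν → Bool) × (Fin r → Bool) ×
        (Fin (k + 1) → {A : Finset (Fin n) // A.card = m})) := fun z =>
    (K z.2.1.2.2).bind fun A => PMF.pure
      ((Fin.cons z.1 fun i => E (sampleBits (fun j => (z.2.1.1 j).getD false) (A i)) z.2.2 :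
        Fin (k + 1) → _), z.2.2, (Fin.cons z.2.1.2.1 A : Fin (k + 1) → _))
  have hκ : ∀ w u a B Z, κ (u, (subsample w B.1, a, B), Z) = (K B).bind fun A => PMF.pure
      ((Fin.cons u fun i => E (sampleBits w (A i)) Z : Fin (k + 1) → _), Z,
        (Fin.cons a A : Fin (k + 1) → _)) := by
    intro w u a B Z
    refine PMF.bind_congr _ fun A hA => ?_
    have hs : ∀ i, sampleBits (fun j => (subsample w B.1 j).getD false) (A i) =
        sampleBits w (A i) := fun i => sampleBits_congr _ fun j hj => by
      simp [subsample, hKsub B A hA i hj]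
    simp only [hs]
  refine le_trans ?_ ((statDist_bind_le _ _ κ).trans (hE _ μ hμ))
  apply le_of_eq
  congr 1
  · simp only [μ, q, pmfProd, PMF.map, PMF.bind_bind, PMF.pure_bind, Function.comp_apply, hκ,
      uniformSubsets_succ]
    refine congrArg _ (funext fun w => ?_)
    rw [PMF.bind_comm]
    refine congrArg _ (funext fun a => ?_)
    rw [PMF.bind_comm (uniformSubset (Fin n) N hN')]
    refine congrArg _ (funext fun Z => ?_)
    rw [← hK, PMF.bind_bind]
    refine congrArg _ (funext fun B => congrArg _ (funext fun A => congrArg _ ?_))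
    refine Prod.ext (funext fun i => ?_) rfl
    cases i using Fin.cases <;> simp
  · simp only [μ, q, pmfProd, PMF.map, PMF.bind_bind, PMF.pure_bind, Function.comp_apply, hκ]
    refine congrArg _ (funext fun w => ?_)
    simp only [PMF.bind_comm (uniformSubsets (Fin n) m k h)]
    rw [PMF.bind_comm]
    refine congrArg _ (funext fun a => ?_)
    rw [PMF.bind_comm (uniformSubset (Fin n) N hN')]
    refine congrArg _ (funext fun Z => ?_)
    rw [PMF.bind_comm (uniformSubset (Fin n) N hN')]
    refine congrArg _ (funext fun u => ?_)
    rw [← hK, PMF.bind_bind]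

/-- If `W` is an `(α,m,N)`-source, `E` is an average case
`(m,α,ν,ε)`-extractor mapping uniform inputs (with an independent uniform seed) to uniform
outputs, `Z` is a uniform seed, `A_1,…,A_k` are independent uniformly random `m`-subsets
(all independent of `W`), `d_i = E(W[A_i], Z)`, and `k·m < N`, then
`Δ((d_1,…,d_k, Z, A_1,…,A_k); (U_1,…,U_k, Z, A_1,…,A_k)) ≤ k·ε`. -/
theorem extract_subsamples_close_to_uniform
    (n m N ν r k : ℕ) (α ε : ℝ) (hm : m ≤ n) (hN : N ≤ n)
    (Wd : PMF (Fin n → Bool)) (hW : IsAlphaSource n Wd α m N hm hN)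
    (E : (Fin m → Bool) → (Fin r → Bool) → (Fin ν → Bool))
    (hE : IsAvgExtractor E α ε)
    (hEunif :
      (pmfProd (PMF.uniformOfFintype (Fin m → Bool))
          (PMF.uniformOfFintype (Fin r → Bool))).map (fun z => E z.1 z.2) =
        PMF.uniformOfFintype (Fin ν → Bool))
    (hk : k * m < N) :
    statDist
      (do
        let w ← Wd
        let Z ← PMF.uniformOfFintype (Fin r → Bool)
        let A ← uniformSubsets (Fin n) m k (by simpa using hm)
        return ((fun i => E (sampleBits w (A i)) Z), Z, A))
      (do
        let Z ← PMF.uniformOfFintype (Fin r → Bool)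
        let A ← uniformSubsets (Fin n) m k (by simpa using hm)
        let U ← PMF.uniformOfFintype (Fin k → Fin ν → Bool)
        return (U, Z, A))
      ≤ k * ε := by
  have h : m ≤ Fintype.card (Fin n) := by simpa using hm
  change statDist
      (Wd.bind fun w => (PMF.uniformOfFintype (Fin r → Bool)).bind fun Z =>
        (uniformSubsets (Fin n) m k h).bind fun A =>
          PMF.pure ((fun i => E (sampleBits w (A i)) Z), Z, A))
      ((PMF.uniformOfFintype (Fin r → Bool)).bind fun Z =>
        (uniformSubsets (Fin n) m k h).bind fun A =>
          (PMF.uniformOfFintype (Fin k → Fin ν → Bool)).bind fun U => PMF.pure (U, Z, A)) ≤ k * ε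
  induction k with
  | zero =>
    rw [Nat.cast_zero, zero_mul]
    refine le_of_eq ((congrArg (statDist _) ?_).trans (statDist_self _))
    refine (PMF.bind_const Wd _).symm.trans (congrArg _ (funext fun w => ?_))
    refine congrArg _ (funext fun Z => congrArg _ (funext fun A => ?_))
    rw [← PMF.bind_const (PMF.uniformOfFintype (Fin 0 → Fin ν → Bool)) (PMF.pure _)]
    exact congrArg _ (funext fun U => congrArg _ (Prod.ext (Subsingleton.elim _ _) rfl))
  | succ k ih =>
    have hk' : k * m < N := lt_of_le_of_lt (Nat.mul_le_mul_right m k.le_succ) hk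
    let κ : (Fin k → Fin ν → Bool) × (Fin r → Bool) ×
        (Fin k → {A : Finset (Fin n) // A.card = m}) →
        PMF ((Fin (k + 1) → Fin ν → Bool) × (Fin r → Bool) ×
          (Fin (k + 1) → {A : Finset (Fin n) // A.card = m})) := fun z =>
      (uniformSubset (Fin n) m h).bind fun a =>
        (PMF.uniformOfFintype (Fin ν → Bool)).bind fun u =>
          PMF.pure ((Fin.cons u z.1 : Fin (k + 1) → _), z.2.1,
            (Fin.cons a z.2.2 : Fin (k + 1) → _))
    have hhyb := (statDist_bind_le _ _ κ).trans (ih hk')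
    refine (statDist_triangle _ _ _).trans
      ((add_le_add (statDist_extract_succ_le hm hN hW hE hk'.le h) ?_).trans_eq
        (show ε + k * ε = (k + 1 : ℕ) * ε by push_cast; ring))
    refine le_of_eq_of_le ?_ hhyb
    congr 1
    · simp only [κ, PMF.bind_bind, PMF.pure_bind]
    · simp only [κ, PMF.bind_bind, PMF.pure_bind, uniformSubsets_succ,
        PMF.uniformOfFintype_fin_succ]
      refine congrArg _ (funext fun Z => ?_)
      rw [PMF.bind_comm]
      refine congrArg _ (funext fun A => ?_)
      simp only [PMF.bind_comm (PMF.uniformOfFintype (Fin k → Fin ν → Bool))]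

end
end

section
/- Let λ ≥ 1 and L ≥ 1, and set F = GF(2^λ). Let m' be any polynomial over F of degree at most L−5 and let t' ∈ F. If x and y are independent uniformly random elements of F, then the probability that x^L + x²·m'(x) + x·y = t' is at most 2^{1−λ}. -/
noncomputable section

/-- An affine equation `f x + x * y = t` has at most `2 * |F|` solutions `(x, y)`: at most `|F|` with
`x = 0`, and one for each `x ≠ 0`. -/
theorem card_filter_add_mul_eq_le {F : Type*} [Field F] [Fintype F] [DecidableEq F]
    (f : F → F) (t : F) :
    (Finset.univ.filter fun z : F × F => f z.1 + z.1 * z.2 = t).card ≤ 2 * Fintype.card F := by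
  have hsub : (Finset.univ.filter fun z : F × F => f z.1 + z.1 * z.2 = t) ⊆
      Finset.univ.image (fun y : F => ((0 : F), y)) ∪
        Finset.univ.image (fun x : F => (x, (t - f x) / x)) := by
    rintro ⟨x, y⟩ h
    simp only [Finset.mem_filter, Finset.mem_univ, true_and] at h
    simp only [Finset.mem_union, Finset.mem_image, Finset.mem_univ, true_and, Prod.mk.injEq]
    by_cases hx : x = 0
    · exact Or.inl ⟨y, hx.symm, rfl⟩
    · refine Or.inr ⟨x, rfl, ?_⟩
      rw [div_eq_iff hx, ← h]
      ring
  calc _ ≤ _ := Finset.card_le_card hsub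
    _ ≤ _ := Finset.card_union_le _ _
    _ ≤ Fintype.card F + Fintype.card F := add_le_add Finset.card_image_le Finset.card_image_le
    _ = 2 * Fintype.card F := (two_mul _).symm

/-- **impersonation bound for the one-time MAC.**
For `F = GF(2^λ)`, any polynomial `m'` of degree at most `L−5` and any `t' ∈ F`, if `x,y`
are independent and uniform over `F`, then
`Pr[x^L + x²·m'(x) + x·y = t'] ≤ 2^{1−λ}`. -/
theorem mac_impersonation_bound
    (lam L : ℕ) (hlam : 1 ≤ lam) (hL : 1 ≤ L)
    (F : Type) [Field F] [Fintype F] [DecidableEq F]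
    (hF : Fintype.card F = 2 ^ lam)
    (m' : Polynomial F) (hm' : m'.degree ≤ (L - 5 : ℕ)) (t' : F) :
    ((Finset.univ.filter fun z : F × F =>
        z.1 ^ L + z.1 ^ 2 * m'.eval z.1 + z.1 * z.2 = t').card : ℝ)
      / (Fintype.card (F × F)) ≤ (2 : ℝ) ^ ((1 : ℤ) - (lam : ℤ)) := by
  have hcard := card_filter_add_mul_eq_le (fun x : F => x ^ L + x ^ 2 * m'.eval x) t'
  rw [hF] at hcard
  have hcard' : ((Finset.univ.filter fun z : F × F =>
      z.1 ^ L + z.1 ^ 2 * m'.eval z.1 + z.1 * z.2 = t').card : ℝ) ≤ 2 * 2 ^ lam := by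
    exact_mod_cast hcard
  rw [Fintype.card_prod, hF, zpow_sub₀ two_ne_zero, zpow_one, zpow_natCast]
  push_cast
  rw [div_le_div_iff₀ (by positivity) (by positivity), ← mul_assoc]
  gcongr

end
end

section
/- Let n, m, t' be natural numbers with m + t' ≤ n, m ≥ 1 and n > m. Let w, w' ∈ {0,1}^n be strings whose Hamming distance is at most t'. Let A be a uniformly random subset of {1,…,n} of cardinality m. Then the probability that w_i = w'_i for every index i ∈ A is at least (1 − t'/(n−m))^m. -/
/-- Multiplying `n.descFactorial k` by the `k`-th power of `1 - t / (n - m)` bounds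
`(n - t).descFactorial k` from below as long as `k ≤ m`. -/
theorem pow_mul_descFactorial_le_descFactorial_sub {n m t k : ℕ} (hmt : m + t ≤ n)
    (hnm : m < n) (hk : k ≤ m) :
    (1 - (t : ℝ) / ((n : ℝ) - m)) ^ k * (n.descFactorial k : ℝ) ≤ ((n - t).descFactorial k : ℝ) := by
  have hpos : (0 : ℝ) < (n : ℝ) - m := sub_pos.2 (by exact_mod_cast hnm)
  have hr : (0 : ℝ) ≤ 1 - (t : ℝ) / ((n : ℝ) - m) := by
    rw [sub_nonneg, div_le_one hpos, le_sub_iff_add_le']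
    exact_mod_cast hmt
  induction k with
  | zero => simp
  | succ k ih =>
    have hkm : (k : ℝ) ≤ m := by exact_mod_cast (Nat.le_of_succ_le hk)
    have hstep : (1 - (t : ℝ) / ((n : ℝ) - m)) * ((n - k : ℕ) : ℝ) ≤ ((n - t - k : ℕ) : ℝ) := by
      have h : (t : ℝ) ≤ (t : ℝ) / ((n : ℝ) - m) * ((n : ℝ) - k) := by
        rw [div_mul_eq_mul_div, le_div_iff₀ hpos]
        gcongr
      rw [Nat.cast_sub (by omega), Nat.cast_sub (by omega), Nat.cast_sub (by omega)]
      linarith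
    rw [Nat.descFactorial_succ, Nat.descFactorial_succ, Nat.cast_mul, Nat.cast_mul, pow_succ]
    calc _ = ((1 - (t : ℝ) / ((n : ℝ) - m)) * ((n - k : ℕ) : ℝ)) *
          ((1 - (t : ℝ) / ((n : ℝ) - m)) ^ k * (n.descFactorial k : ℝ)) := by ring
      _ ≤ _ := by
        gcongr
        exact ih (Nat.le_of_succ_le hk)

theorem pow_mul_choose_le_choose_sub {n m t : ℕ} (hmt : m + t ≤ n) (hnm : m < n) :
    (1 - (t : ℝ) / ((n : ℝ) - m)) ^ m * (n.choose m : ℝ) ≤ ((n - t).choose m : ℝ) := by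
  have h := pow_mul_descFactorial_le_descFactorial_sub hmt hnm le_rfl
  rw [Nat.descFactorial_eq_factorial_mul_choose, Nat.descFactorial_eq_factorial_mul_choose,
    Nat.cast_mul, Nat.cast_mul, mul_left_comm] at h
  exact le_of_mul_le_mul_left h (by exact_mod_cast m.factorial_pos)

/-- The number of `m`-subsets on which two strings agree. -/
theorem card_filter_forall_mem_eq {ι α : Type*} [Fintype ι] [DecidableEq ι] [DecidableEq α]
    (m : ℕ) (w w' : ι → α)
    [DecidablePred fun A : {s : Finset ι // s.card = m} => ∀ i ∈ A.1, w i = w' i] :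
    (Finset.univ.filter fun A : {s : Finset ι // s.card = m} => ∀ i ∈ A.1, w i = w' i).card =
      (Fintype.card ι - hammingDist w w').choose m := by
  have hagree : (Finset.univ.filter fun i => w i = w' i).card =
      Fintype.card ι - hammingDist w w' := by
    have h := Finset.card_filter_add_card_filter_not (s := Finset.univ) (fun i => w i = w' i)
    rw [Finset.card_univ] at h
    exact Nat.eq_sub_of_add_eq h
  rw [← hagree, ← Finset.card_powersetCard,
    ← Finset.card_map (Function.Embedding.subtype fun s : Finset ι => s.card = m)]
  congr 1
  ext s
  simp [Finset.mem_powersetCard, Finset.subset_iff, and_comm]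


/-- Let `m + t' ≤ n`, `m ≥ 1`, `n > m`, and let `w, w' ∈ {0,1}^n` have
Hamming distance at most `t'`.  If `A` is a uniformly random `m`-subset of `{1,…,n}`,
then `Pr[∀ i ∈ A, w_i = w'_i] ≥ (1 − t'/(n−m))^m`. -/
theorem subsample_match_probability
    (n m t' : ℕ) (hmt : m + t' ≤ n) (hm1 : 1 ≤ m) (hnm : m < n)
    (w w' : Fin n → Bool) (hdist : hammingDist w w' ≤ t') :
    (1 - (t' : ℝ) / ((n : ℝ) - (m : ℝ))) ^ m ≤
      ((Finset.univ.filter fun A : {s : Finset (Fin n) // s.card = m} =>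
          ∀ i ∈ A.1, w i = w' i).card : ℝ)
        / (Fintype.card {s : Finset (Fin n) // s.card = m}) := by
  rw [card_filter_forall_mem_eq, Fintype.card_finset_len, Fintype.card_fin,
    le_div_iff₀ (by exact_mod_cast Nat.choose_pos hnm.le)]
  refine (pow_mul_choose_le_choose_sub hmt hnm).trans ?_
  exact_mod_cast Nat.choose_le_choose m (Nat.sub_le_sub_left hdist n)
end

section
/- Let n, m, t', ℓ be natural numbers with m + t' ≤ n, m ≥ 1, n > m and ℓ ≥ 1. Let w, w' ∈ {0,1}^n be strings whose Hamming distance is at most t'. Let A_1,…,A_ℓ be independent uniformly random subsets of {1,…,n}, each of cardinality m. Then the probability that for every j ∈ {1,…,ℓ} there exists an index i ∈ A_j with w_i ≠ w'_i is at most (1 − (1 − t'/(n−m))^m)^ℓ. -/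
/-- Sampling without replacement: the chance that an `m`-subset of an `n`-set avoids a fixed set of
`d ≤ t` points is at least `(1 - t / (n - m)) ^ m`. -/
theorem one_sub_div_pow_mul_choose_le {n m t d : ℕ} (hmt : m + t ≤ n) (hnm : m < n)
    (hd : d ≤ t) :
    (1 - (t : ℝ) / ((n : ℝ) - (m : ℝ))) ^ m * (n.choose m : ℝ) ≤ ((n - d).choose m : ℝ) := by
  have hpos : (0 : ℝ) < (n : ℝ) - m := sub_pos.mpr (by exact_mod_cast hnm)
  have hmt' : (m : ℝ) + t ≤ n := by exact_mod_cast hmt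
  have hd' : (d : ℝ) ≤ t := by exact_mod_cast hd
  have hdesc : (1 - (t : ℝ) / ((n : ℝ) - (m : ℝ))) ^ m * (n.descFactorial m : ℝ)
      ≤ ((n - d).descFactorial m : ℝ) := by
    rw [Nat.descFactorial_eq_prod_range, Nat.descFactorial_eq_prod_range, Nat.cast_prod,
      Nat.cast_prod]
    nth_rewrite 2 [← Finset.card_range m]
    rw [← Finset.prod_const, ← Finset.prod_mul_distrib]
    have hq : 0 ≤ 1 - (t : ℝ) / ((n : ℝ) - (m : ℝ)) := by
      rw [sub_nonneg, div_le_one hpos]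
      linarith
    refine Finset.prod_le_prod (fun i _ => mul_nonneg hq (Nat.cast_nonneg _)) fun i hi => ?_
    have him : i < m := Finset.mem_range.mp hi
    have him' : (i : ℝ) ≤ m := by exact_mod_cast him.le
    rw [Nat.cast_sub (by omega : i ≤ n - d), Nat.cast_sub (by omega : d ≤ n),
      Nat.cast_sub (by omega : i ≤ n)]
    have ht : (t : ℝ) ≤ t / ((n : ℝ) - m) * ((n : ℝ) - i) := by
      rw [div_mul_eq_mul_div, le_div_iff₀ hpos]
      exact mul_le_mul_of_nonneg_left (by linarith) (Nat.cast_nonneg t)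
    linarith
  rw [Nat.descFactorial_eq_factorial_mul_choose, Nat.descFactorial_eq_factorial_mul_choose] at hdesc
  push_cast at hdesc
  have hfac : (0 : ℝ) < (m.factorial : ℝ) := by exact_mod_cast m.factorial_pos
  refine le_of_mul_le_mul_left ?_ hfac
  linarith

/-- The number of `m`-subsets containing no point at which `p` holds. -/
theorem card_filter_not_exists_mem {α : Type*} [Fintype α] [DecidableEq α] (m : ℕ)
    (p : α → Prop) [DecidablePred p] :
    (Finset.univ.filter fun s : {s : Finset α // s.card = m} => ¬ ∃ i ∈ s.1, p i).card
      = (Fintype.card α - (Finset.univ.filter p).card).choose m := by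
  rw [← Finset.card_compl, ← Finset.card_powersetCard,
    ← Finset.card_map (Function.Embedding.subtype _)]
  congr 1
  ext s
  simp only [Finset.mem_map, Finset.mem_filter, Finset.mem_univ, true_and, Finset.mem_powersetCard,
    Function.Embedding.subtype_apply, Subtype.exists, exists_and_right, exists_eq_right,
    Finset.subset_iff, Finset.mem_compl]
  grind

/-- Let `m + t' ≤ n`, `m ≥ 1`, `n > m`, `ℓ ≥ 1`, and let
`w, w' ∈ {0,1}^n` have Hamming distance at most `t'`.  If `A_1,…,A_ℓ` are independent
uniformly random `m`-subsets of `{1,…,n}`, then the probability that every `A_j` contains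
a position where `w` and `w'` differ is at most `(1 − (1 − t'/(n−m))^m)^ℓ`. -/
theorem all_subsamples_mismatch_probability
    (n m t' ℓ : ℕ) (hmt : m + t' ≤ n) (hm1 : 1 ≤ m) (hnm : m < n) (hℓ : 1 ≤ ℓ)
    (w w' : Fin n → Bool) (hdist : hammingDist w w' ≤ t') :
    ((Finset.univ.filter fun A : Fin ℓ → {s : Finset (Fin n) // s.card = m} =>
        ∀ j : Fin ℓ, ∃ i ∈ (A j).1, w i ≠ w' i).card : ℝ)
      / (Fintype.card (Fin ℓ → {s : Finset (Fin n) // s.card = m}))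
      ≤ (1 - (1 - (t' : ℝ) / ((n : ℝ) - (m : ℝ))) ^ m) ^ ℓ := by
  have hcard : Fintype.card {s : Finset (Fin n) // s.card = m} = n.choose m := by
    rw [Fintype.card_finset_len, Fintype.card_fin]
  have hchoose : (0 : ℝ) < (n.choose m : ℝ) := by exact_mod_cast Nat.choose_pos hnm.le
  have hpi : (Finset.univ.filter fun A : Fin ℓ → {s : Finset (Fin n) // s.card = m} =>
        ∀ j : Fin ℓ, ∃ i ∈ (A j).1, w i ≠ w' i)
      = Fintype.piFinset fun _ : Fin ℓ =>
        Finset.univ.filter fun s : {s : Finset (Fin n) // s.card = m} =>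
          ∃ i ∈ s.1, w i ≠ w' i := by
    ext A
    simp [Fintype.mem_piFinset]
  have hsplit : (Finset.univ.filter fun s : {s : Finset (Fin n) // s.card = m} =>
      ∃ i ∈ s.1, w i ≠ w' i).card + (n - hammingDist w w').choose m = n.choose m := by
    have havoid := card_filter_not_exists_mem m fun i => w i ≠ w' i
    rw [Fintype.card_fin] at havoid
    rw [hammingDist, ← havoid, ← hcard, ← Finset.card_univ]
    convert Finset.card_filter_add_card_filter_not _
  have hbound := one_sub_div_pow_mul_choose_le hmt hnm hdist
  have hsplit' := congrArg (Nat.cast : ℕ → ℝ) hsplit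
  push_cast at hsplit'
  rw [hpi, Fintype.card_piFinset_const, Fintype.card_fun, hcard, Fintype.card_fin, Nat.cast_pow,
    Nat.cast_pow, ← div_pow]
  refine pow_le_pow_left₀ (by positivity) ?_ ℓ
  rw [div_le_iff₀ hchoose]
  linarith
end
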